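/- For every real number α with 0 < α ≤ 1/2 there exists a constant C = C_α such that for every positive integer n, taking k = ⌊αn⌋, one has E_k(n) ≤ C; that is, there exists a Boolean function f on the k-element subsets of [n] with deterministic query complexity D_k(f) ≥ n − C. -/

import Mathlib

/-- A (binary) decision tree over ground set `[n]` (positions `Fin n`):
leaves are labelled with a Boolean output, inner nodes with a query `i ∈ [n]`;
the left subtree corresponds to the answer `i ∉ A`, the right one to `i ∈ A`. -/
inductive DecTree (n : ℕ) : Type
  | leaf : Bool → DecTree n
  | node : Fin n → DecTree n → DecTree n → DecTree n

namespace DecTree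

/-- The height (depth) of a decision tree: the maximum number of queries on a
root-to-leaf path. -/
def depth {n : ℕ} : DecTree n → ℕ
  | leaf _ => 0
  | node _ t0 t1 => max (depth t0) (depth t1) + 1

/-- Evaluate a decision tree on an input set `A ⊆ [n]`. -/
def eval {n : ℕ} : DecTree n → Finset (Fin n) → Bool
  | leaf b, _ => b
  | node i t0 t1, A => if i ∈ A then eval t1 A else eval t0 A

end DecTree

/-- The slice: the `k`-element subsets of `[n]`. -/
def Slice (n k : ℕ) : Type := {A : Finset (Fin n) // A.card = k}

/-- A decision tree computes `f` on the slice if it evaluates to `f A` for every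
`A` in the slice. -/
def Computes {n k : ℕ} (T : DecTree n) (f : Slice n k → Bool) : Prop :=
  ∀ A : Slice n k, T.eval A.val = f A

/-- Deterministic query complexity of `f` on the slice: the minimum height of a
decision tree computing `f`. -/
noncomputable def Dquery (n k : ℕ) (f : Slice n k → Bool) : ℕ :=
  sInf {d : ℕ | ∃ T : DecTree n, T.depth ≤ d ∧ Computes T f}

/-- `Dmax n k`: the maximum deterministic query complexity over all Boolean
functions on the slice of `k`-subsets of `[n]`. -/
noncomputable def Dmax (n k : ℕ) : ℕ :=
  sSup {d : ℕ | ∃ f : Slice n k → Bool, Dquery n k f = d}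

/-- `Equery n k = n - Dmax n k`. -/
noncomputable def Equery (n k : ℕ) : ℕ := n - Dmax n k

open Finset

theorem le_choose_of_pos_of_lt {N j : ℕ} (hj : 0 < j) (hjN : j < N) : N ≤ N.choose j := by
  induction N generalizing j with
  | zero => omega
  | succ N ih =>
    obtain ⟨j, rfl⟩ := Nat.exists_eq_succ_of_ne_zero hj.ne'
    rw [Nat.choose_succ_succ]
    have hpos : 0 < N.choose j := Nat.choose_pos (by omega)
    rcases Nat.lt_or_ge (j + 1) N with h | h
    · have := ih (Nat.succ_pos j) h
      simp only [Nat.succ_eq_add_one] at *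
      omega
    · obtain rfl : N = j + 1 := by omega
      simp

theorem choose_sub_le_pow_mul_choose {N K : ℕ} {q : ℝ} (hq : 0 ≤ q)
    (hK : (1 - q) * N ≤ K) (s : ℕ) (hs : s ≤ N) :
    ((N - s).choose K : ℝ) ≤ q ^ s * N.choose K := by
  induction s with
  | zero => simp
  | succ s ih =>
    obtain ⟨m, hm⟩ : ∃ m, N - s = m + 1 := ⟨N - s - 1, by omega⟩
    rw [show N - (s + 1) = m by omega]
    have ih := ih (by omega)
    rw [hm] at ih
    suffices h : (m.choose K : ℝ) ≤ q * (m + 1).choose K by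
      calc (m.choose K : ℝ) ≤ q * (m + 1).choose K := h
        _ ≤ q * (q ^ s * N.choose K) := by gcongr
        _ = q ^ (s + 1) * N.choose K := by ring
    rcases Nat.lt_or_ge m K with hmK | hmK
    · simpa [Nat.choose_eq_zero_of_lt hmK] using mul_nonneg hq (Nat.cast_nonneg _)
    have hrec : (m.choose K : ℝ) * (m + 1) = (m + 1).choose K * ((m : ℝ) + 1 - K) := by
      have h := Nat.choose_mul_succ_eq m K
      have hsub : ((m + 1 - K : ℕ) : ℝ) = (m : ℝ) + 1 - K := by
        rw [Nat.cast_sub (by omega)]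
        push_cast
        ring
      rw [← hsub]
      exact_mod_cast h
    have hKle : (m : ℝ) + 1 - K ≤ q * (m + 1) := by
      have h1 : (m : ℝ) + 1 ≤ N := by exact_mod_cast (by omega : m + 1 ≤ N)
      have h2 : (K : ℝ) ≤ m := by exact_mod_cast hmK
      rcases le_total q 1 with h | h
      · nlinarith
      · nlinarith [Nat.cast_nonneg (α := ℝ) m, Nat.cast_nonneg (α := ℝ) K]
    have hm0 : (0 : ℝ) < (m : ℝ) + 1 := by positivity
    refine le_of_mul_le_mul_right ?_ hm0
    rw [hrec]
    calc ((m + 1).choose K : ℝ) * ((m : ℝ) + 1 - K)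
        ≤ (m + 1).choose K * (q * (m + 1)) := by gcongr
      _ = q * (m + 1).choose K * (m + 1) := by ring

theorem four_mul_choose_le {α : ℝ} (hα1 : α ≤ 1) {s n l : ℕ}
    (hs : (1 - α / 2) ^ s ≤ α / 8) (hn : 0 < n) (hsn : s ≤ n) (hl : α * n ≤ l + 1) :
    4 * (n + 1 - s).choose (l + 1) ≤ n.choose l := by
  have hn1 : (1 : ℝ) ≤ n := by exact_mod_cast hn
  have hK : α / 2 * (n + 1) ≤ (l : ℝ) + 1 := by nlinarith
  have h := choose_sub_le_pow_mul_choose (N := n + 1) (K := l + 1) (q := 1 - α / 2)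
    (by linarith) (by push_cast; linarith) s (by omega)
  have hrec : ((n : ℝ) + 1) * n.choose l = (n + 1).choose (l + 1) * ((l : ℝ) + 1) := by
    exact_mod_cast Nat.add_one_mul_choose_eq n l
  have h1 : ((n + 1 - s).choose (l + 1) : ℝ) ≤ α / 8 * (n + 1).choose (l + 1) :=
    h.trans (by gcongr)
  have h2 : α / 2 * (n + 1).choose (l + 1) ≤ (n.choose l : ℝ) := by
    have hn0 : (0 : ℝ) < (n : ℝ) + 1 := by positivity
    refine le_of_mul_le_mul_left ?_ hn0
    rw [hrec]
    nlinarith [mul_le_mul_of_nonneg_left hK (Nat.cast_nonneg (α := ℝ) ((n + 1).choose (l + 1)))]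
  have h3 : (4 : ℝ) * (n + 1 - s).choose (l + 1) ≤ n.choose l := by linarith
  exact_mod_cast h3

/-- Exponent bounding the number of functions that remain computable when `z` zeros and `o` ones
are still unqueried. It satisfies Pascal's recursion. -/
def treeWeight (s z o : ℕ) : ℕ :=
  2 * (z + o + 1 - s).choose (o + 1) + 2 * (z + o + 1 - s).choose (z + 1)

theorem treeWeight_succ_succ {s z o : ℕ} (hs : s ≤ z + o) :
    treeWeight s (z + 1) (o + 1) = treeWeight s z (o + 1) + treeWeight s (z + 1) o := by
  obtain ⟨m, hm⟩ := Nat.exists_eq_add_of_le hs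
  unfold treeWeight
  rw [show z + 1 + (o + 1) + 1 - s = (m + 2) + 1 by omega,
    show z + (o + 1) + 1 - s = m + 2 by omega, show z + 1 + o + 1 - s = m + 2 by omega,
    Nat.choose_succ_succ (m + 2) (o + 1), Nat.choose_succ_succ (m + 2) (z + 1)]
  simp only [Nat.succ_eq_add_one]
  ring

theorem le_treeWeight {s z o : ℕ} (hs : 2 * s + 2 ≤ z + o)
    (h : z = 0 ∨ o = 0 ∨ z + o = 2 * s + 2) : z + o + 3 ≤ treeWeight s z o := by
  unfold treeWeight
  by_cases ho : o = 0
  · subst ho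
    simp only [zero_add, Nat.choose_one_right]
    omega
  by_cases hz : z = 0
  · subst hz
    simp only [zero_add, Nat.choose_one_right]
    omega
  have hzo : z + o = 2 * s + 2 := by omega
  rcases le_total o z with hle | hle
  · have := le_choose_of_pos_of_lt (N := z + o + 1 - s) (j := o + 1) (by omega) (by omega)
    omega
  · have := le_choose_of_pos_of_lt (N := z + o + 1 - s) (j := z + 1) (by omega) (by omega)
    omega

namespace DecTree

theorem exists_eval_eq {n : ℕ} (S : Finset (Fin n)) (g : Finset (Fin n) → Bool) :
    ∃ T : DecTree n, ∀ A, T.eval A = g (A ∩ S) := by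
  induction S using Finset.induction_on generalizing g with
  | empty => exact ⟨leaf (g ∅), fun A => by simp [eval]⟩
  | insert i S _ ih =>
    obtain ⟨T₀, h₀⟩ := ih g
    obtain ⟨T₁, h₁⟩ := ih fun B => g (insert i B)
    refine ⟨node i T₀ T₁, fun A => ?_⟩
    by_cases hi : i ∈ A
    · simp [eval, hi, h₁, Finset.inter_insert_of_mem]
    · simp [eval, hi, h₀, Finset.inter_insert_of_notMem]

theorem exists_computes {n k : ℕ} (f : Slice n k → Bool) : ∃ T : DecTree n, Computes T f := by
  obtain ⟨T, hT⟩ := exists_eval_eq (n := n) univ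
    fun A => if h : A.card = k then f ⟨A, h⟩ else false
  refine ⟨T, fun A => ?_⟩
  rw [hT, Finset.inter_univ, dif_pos A.2]
  rfl

theorem exists_family_of_forall_eval_const {n k d s z o : ℕ} {Q P : Finset (Fin n)}
    (hn : 2 * s + 2 ≤ z + o) (hzo : z = 0 ∨ o = 0 ∨ z + o = 2 * s + 2)
    (hconst : ∀ T : DecTree n, T.depth ≤ d →
      ∃ b : Bool, ∀ A : Finset (Fin n), A ∩ Q = P → A.card = k → T.eval A = b) :
    ∃ F : Finset (Finset (Fin n) → Bool), F.card * 2 ^ (z + o + 2) ≤ 2 ^ treeWeight s z o ∧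
      ∀ T : DecTree n, T.depth ≤ d →
        ∃ g ∈ F, ∀ A : Finset (Fin n), A ∩ Q = P → A.card = k → T.eval A = g A := by
  refine ⟨univ.image fun b _ => b, ?_, fun T hT => ?_⟩
  · calc _ ≤ 2 * 2 ^ (z + o + 2) := by
          gcongr
          exact card_image_le.trans (by simp)
      _ = 2 ^ (z + o + 3) := by ring
      _ ≤ _ := Nat.pow_le_pow_right (by norm_num) (le_treeWeight hn hzo)
  · obtain ⟨b, hb⟩ := hconst T hT
    exact ⟨fun _ => b, mem_image_of_mem _ (mem_univ b), hb⟩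

/-- After the queries in `Q` were answered by `P`, the trees of depth at most `d` compute at most
`2 ^ (treeWeight s z o - (z + o) - 2)` functions. -/
theorem exists_family {n k s : ℕ} (d : ℕ) (z o : ℕ) (Q P : Finset (Fin n)) (hPQ : P ⊆ Q)
    (hQ : Q.card + (z + o) = n) (hP : P.card + o = k) (hd : z + o = 2 * s + 2 + d) :
    ∃ F : Finset (Finset (Fin n) → Bool), F.card * 2 ^ (z + o + 2) ≤ 2 ^ treeWeight s z o ∧
      ∀ T : DecTree n, T.depth ≤ d →
        ∃ g ∈ F, ∀ A : Finset (Fin n), A ∩ Q = P → A.card = k → T.eval A = g A := by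
  induction d generalizing z o Q P with
  | zero =>
    refine exists_family_of_forall_eval_const (by omega) (by omega) fun T hT => ?_
    cases T with
    | leaf b => exact ⟨b, fun _ _ _ => rfl⟩
    | node i T₀ T₁ => simp [depth] at hT
  | succ d ih =>
    rcases z with _ | z
    · refine exists_family_of_forall_eval_const (by omega) (Or.inl rfl)
        fun T _ => ⟨T.eval (P ∪ Qᶜ), fun A hA hAk => ?_⟩
      congr 1
      refine Finset.eq_of_subset_of_card_le (fun x hx => ?_) ?_
      · by_cases hxQ : x ∈ Q
        · exact mem_union_left _ (hA ▸ mem_inter.2 ⟨hx, hxQ⟩)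
        · exact mem_union_right _ (mem_compl.2 hxQ)
      · refine (card_union_le _ _).trans ?_
        rw [card_compl, Fintype.card_fin]
        omega
    rcases o with _ | o
    · refine exists_family_of_forall_eval_const (by omega) (Or.inr (Or.inl rfl))
        fun T _ => ⟨T.eval P, fun A hA hAk => ?_⟩
      congr 1
      refine (Finset.eq_of_subset_of_card_le (hA ▸ inter_subset_left) ?_).symm
      omega
    choose F₀ hcard₀ hF₀ using fun (i : Fin n) (hi : i ∉ Q) =>
      ih z (o + 1) (insert i Q) P (hPQ.trans (subset_insert i Q))
        (by rw [card_insert_of_notMem hi]; omega) hP (by omega)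
    choose F₁ hcard₁ hF₁ using fun (i : Fin n) (hi : i ∉ Q) =>
      ih (z + 1) o (insert i Q) (insert i P) (insert_subset_insert i hPQ)
        (by rw [card_insert_of_notMem hi]; omega)
        (by rw [card_insert_of_notMem fun h => hi (hPQ h)]; omega) (by omega)
    let F : Finset (Finset (Fin n) → Bool) := Qᶜ.attach.biUnion fun i =>
      (F₀ i (mem_compl.1 i.2) ×ˢ F₁ i (mem_compl.1 i.2)).image
        fun p A => if i.1 ∈ A then p.2 A else p.1 A
    have hnode : ∀ i ∉ Q, ∀ T₀ T₁ : DecTree n, T₀.depth ≤ d → T₁.depth ≤ d → ∃ g ∈ F,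
        ∀ A : Finset (Fin n), A ∩ Q = P → A.card = k → (node i T₀ T₁).eval A = g A := by
      intro i hi T₀ T₁ h₀ h₁
      obtain ⟨g₀, hg₀, hA₀⟩ := hF₀ i hi T₀ h₀
      obtain ⟨g₁, hg₁, hA₁⟩ := hF₁ i hi T₁ h₁
      refine ⟨fun A => if i ∈ A then g₁ A else g₀ A, mem_biUnion.2 ⟨⟨i, mem_compl.2 hi⟩,
        mem_attach _ _, mem_image.2 ⟨(g₀, g₁), mem_product.2 ⟨hg₀, hg₁⟩, rfl⟩⟩, fun A hA hAk => ?_⟩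
      by_cases hiA : i ∈ A
      · simp only [eval, hiA, if_true]
        exact hA₁ A (by rw [inter_insert_of_mem hiA, hA]) hAk
      · simp only [eval, hiA, if_false]
        exact hA₀ A (by rw [inter_insert_of_notMem hiA, hA]) hAk
    refine ⟨F, ?_, fun T hT => ?_⟩
    · set r := z + o + 1 with hr
      have hF : F.card * 2 ^ (2 * r + 4) ≤
          (r + 1) * (2 ^ treeWeight s z (o + 1) * 2 ^ treeWeight s (z + 1) o) := by
        calc F.card * 2 ^ (2 * r + 4)
            ≤ (∑ i ∈ Qᶜ.attach, (F₀ i (mem_compl.1 i.2)).card * (F₁ i (mem_compl.1 i.2)).card)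
              * 2 ^ (2 * r + 4) := by
              gcongr
              refine card_biUnion_le.trans (sum_le_sum fun i _ => ?_)
              exact card_image_le.trans (card_product _ _).le
          _ = ∑ i ∈ Qᶜ.attach, ((F₀ i (mem_compl.1 i.2)).card * 2 ^ (z + (o + 1) + 2)) *
              ((F₁ i (mem_compl.1 i.2)).card * 2 ^ (z + 1 + o + 2)) := by
              rw [sum_mul]
              refine sum_congr rfl fun i _ => ?_
              rw [show 2 * r + 4 = (z + (o + 1) + 2) + (z + 1 + o + 2) by omega, pow_add]
              ring
          _ ≤ ∑ i ∈ Qᶜ.attach, 2 ^ treeWeight s z (o + 1) * 2 ^ treeWeight s (z + 1) o :=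
              sum_le_sum fun i _ => Nat.mul_le_mul (hcard₀ _ _) (hcard₁ _ _)
          _ = (r + 1) * (2 ^ treeWeight s z (o + 1) * 2 ^ treeWeight s (z + 1) o) := by
              rw [sum_const, card_attach, card_compl, Fintype.card_fin, smul_eq_mul]
              congr 1
              omega
      rw [← pow_add, ← treeWeight_succ_succ (by omega)] at hF
      refine le_of_mul_le_mul_right ?_ (by positivity : 0 < 2 ^ (r + 1))
      calc F.card * 2 ^ (z + 1 + (o + 1) + 2) * 2 ^ (r + 1) = F.card * 2 ^ (2 * r + 4) := by
            rw [mul_assoc, ← pow_add]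
            congr 2
            omega
        _ ≤ (r + 1) * 2 ^ treeWeight s (z + 1) (o + 1) := hF
        _ ≤ 2 ^ (r + 1) * 2 ^ treeWeight s (z + 1) (o + 1) := by
            gcongr
            exact Nat.lt_two_pow_self.le
        _ = _ := mul_comm _ _
    · induction T with
      | leaf b =>
        obtain ⟨i, hi⟩ : ∃ i, i ∈ Qᶜ := by
          refine card_pos.1 ?_
          rw [card_compl, Fintype.card_fin]
          omega
        simpa [eval] using hnode i (mem_compl.1 hi) (leaf b) (leaf b) (Nat.zero_le _) (Nat.zero_le _)
      | node i T₀ T₁ ih₀ ih₁ =>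
        have hT' : max T₀.depth T₁.depth ≤ d := Nat.le_of_succ_le_succ hT
        have h₀ := (le_max_left _ _).trans hT'
        have h₁ := (le_max_right _ _).trans hT'
        by_cases hi : i ∈ Q
        · have hmem : ∀ A : Finset (Fin n), A ∩ Q = P → (i ∈ A ↔ i ∈ P) := by
            rintro A rfl
            simp [hi]
          by_cases hiP : i ∈ P
          · obtain ⟨g, hg, hA⟩ := ih₁ (by omega)
            refine ⟨g, hg, fun A h hk => ?_⟩
            rw [← hA A h hk]
            simp [eval, (hmem A h).2 hiP]
          · obtain ⟨g, hg, hA⟩ := ih₀ (by omega)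
            refine ⟨g, hg, fun A h hk => ?_⟩
            rw [← hA A h hk]
            simp [eval, (hmem A h).not.2 hiP]
        · exact hnode i hi T₀ T₁ h₀ h₁

end DecTree

theorem exists_lt_dquery {n k s : ℕ} (hk : k ≤ n) (hn : 2 * s + 2 ≤ n)
    (hw : treeWeight s (n - k) k ≤ n.choose k) :
    ∃ f : Slice n k → Bool, n - (2 * s + 2) < Dquery n k f := by
  obtain ⟨F, hF, hT⟩ := DecTree.exists_family (n := n) (k := k) (s := s) (n - (2 * s + 2)) (n - k) k
    ∅ ∅ (Finset.Subset.refl _) (by simp; omega) (by simp) (by omega)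
  by_contra! hcon
  have hcomp : ∀ f : Slice n k → Bool, ∃ g ∈ F, ∀ A : Slice n k, f A = g A.val := by
    intro f
    have hne : {d : ℕ | ∃ T : DecTree n, T.depth ≤ d ∧ Computes T f}.Nonempty := by
      obtain ⟨T, h⟩ := DecTree.exists_computes f
      exact ⟨T.depth, T, le_rfl, h⟩
    obtain ⟨T, hTd, hTf⟩ := Nat.sInf_mem hne
    obtain ⟨g, hg, hgA⟩ := hT T (hTd.trans (hcon f))
    exact ⟨g, hg, fun A => (hTf A).symm.trans (hgA _ (by simp) A.2)⟩
  choose G hGF hG using hcomp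
  have hinj : Function.Injective fun f => (⟨G f, hGF f⟩ : F) := by
    intro f f' h
    have h' : G f = G f' := congrArg Subtype.val h
    funext A
    rw [hG f A, hG f' A, h']
  have hcard := Nat.card_le_card_of_injective _ hinj
  have hslice : Nat.card (Slice n k) = n.choose k := by
    unfold Slice
    simp
  have : Finite (Slice n k) := inferInstanceAs (Finite {A : Finset (Fin n) // A.card = k})
  rw [Nat.card_fun, hslice] at hcard
  simp only [Nat.card_eq_fintype_card, Fintype.card_bool, Fintype.card_coe] at hcard
  have h1 : 2 ^ treeWeight s (n - k) k ≤ F.card :=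
    (Nat.pow_le_pow_right (by norm_num) hw).trans hcard
  have h2 : 1 < 2 ^ (n - k + k + 2) := Nat.one_lt_two_pow (by omega)
  have h3 : 0 < F.card := lt_of_lt_of_le (by positivity) h1
  nlinarith

theorem dquery_le_dmax {n k : ℕ} (f : Slice n k → Bool) : Dquery n k f ≤ Dmax n k := by
  have : Finite (Slice n k) := inferInstanceAs (Finite {A : Finset (Fin n) // A.card = k})
  exact le_csSup (Set.finite_range (Dquery n k)).bddAbove ⟨f, rfl⟩

/-- For every real `0 < α ≤ 1/2` there is a constant `C` such that for every
positive `n`, with `k = ⌊α n⌋`, one has `E_k(n) ≤ C`: there is a Boolean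
function on the slice with query complexity `≥ n - C`. -/
theorem stmt_2 (α : ℝ) (hα0 : 0 < α) (hα1 : α ≤ 1 / 2) :
    ∃ C : ℕ, ∀ n : ℕ, 0 < n →
      Equery n ⌊α * n⌋₊ ≤ C ∧
      ∃ f : Slice n ⌊α * n⌋₊ → Bool, n - C ≤ Dquery n ⌊α * n⌋₊ f := by
  obtain ⟨s, hs⟩ := exists_pow_lt_of_lt_one (by positivity : 0 < α / 8)
    (by linarith : 1 - α / 2 < 1)
  refine ⟨2 * s + 2, fun n hn => ?_⟩
  suffices h : ∃ f : Slice n ⌊α * n⌋₊ → Bool, n - (2 * s + 2) ≤ Dquery n ⌊α * n⌋₊ f by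
    refine ⟨?_, h⟩
    obtain ⟨f, hf⟩ := h
    have := hf.trans (dquery_le_dmax f)
    unfold Equery
    omega
  rcases Nat.lt_or_ge n (2 * s + 2) with hns | hns
  · exact ⟨fun _ => false, by omega⟩
  have hn0 : (0 : ℝ) < n := by exact_mod_cast hn
  set k := ⌊α * n⌋₊ with hk
  have hkle : (k : ℝ) ≤ α * n := Nat.floor_le (by positivity)
  have hkn : k ≤ n := by
    have : (k : ℝ) ≤ n := by nlinarith
    exact_mod_cast this
  have h1 := four_mul_choose_le (by linarith) hs.le hn (by omega : s ≤ n)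
    (l := k) (Nat.lt_floor_add_one (α * n)).le
  have h2 := four_mul_choose_le (by linarith) hs.le hn (by omega : s ≤ n)
    (l := n - k) (by rw [Nat.cast_sub hkn]; nlinarith)
  rw [Nat.choose_symm hkn] at h2
  obtain ⟨f, hf⟩ := exists_lt_dquery hkn hns (by
    unfold treeWeight
    rw [Nat.sub_add_cancel hkn]
    omega)
  exact ⟨f, hf.le⟩
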